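/- Let N ≥ 3 be an integer, x₀ ∈ ℝ^N, S_{x₀}(x) := 1/((N−2)ω_N |x−x₀|^{N−2}), and let Φ be a real function that is harmonic on an open ball B_d(x₀) for some d > 0. Set G := S_{x₀} − Φ (defined on B_d(x₀) \ {x₀}). Then lim_{θ→0⁺} P_θ(G, G) = −((N−2)/2) Φ(x₀). (When G is the Green's function of a domain with pole x₀ and Φ its regular part, the right-hand side equals −((N−2)/2) times the Robin function at x₀.) -/

import Mathlib

open MeasureTheory Metric Real
open scoped RealInnerProductSpace ENNReal

/-- The Euclidean Laplacian `Δu = Σ_{i=1}^N ∂²u/∂x_i²` on `ℝ^N`. -/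
noncomputable def laplacian {N : ℕ} (u : EuclideanSpace ℝ (Fin N) → ℝ)
    (x : EuclideanSpace ℝ (Fin N)) : ℝ :=
  ∑ i : Fin N, fderiv ℝ (fun y => fderiv ℝ u y (EuclideanSpace.single i 1)) x
    (EuclideanSpace.single i 1)

/-- The quadratic boundary form
`P_θ(u,v) = -θ∫_{∂B_θ(x₀)} ⟨∇u,ν⟩⟨∇v,ν⟩ + (θ/2)∫ ⟨∇u,∇v⟩
  + ((2-N)/4)∫ ⟨∇u,ν⟩ v + ((2-N)/4)∫ ⟨∇v,ν⟩ u`,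
where `ν(x) = (x-x₀)/θ` and integrals are over the sphere `∂B_θ(x₀)` with respect to the
`(N-1)`-dimensional Hausdorff measure. -/
noncomputable def Pform {N : ℕ} (x₀ : EuclideanSpace ℝ (Fin N)) (θ : ℝ)
    (u v : EuclideanSpace ℝ (Fin N) → ℝ) : ℝ :=
  -θ * ∫ x in sphere x₀ θ,
      (⟪gradient u x, θ⁻¹ • (x - x₀)⟫) * (⟪gradient v x, θ⁻¹ • (x - x₀)⟫) ∂μH[(N : ℝ) - 1]
  + (θ / 2) * ∫ x in sphere x₀ θ,
      (⟪gradient u x, gradient v x⟫) ∂μH[(N : ℝ) - 1]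
  + ((2 - (N : ℝ)) / 4) * ∫ x in sphere x₀ θ,
      (⟪gradient u x, θ⁻¹ • (x - x₀)⟫) * v x ∂μH[(N : ℝ) - 1]
  + ((2 - (N : ℝ)) / 4) * ∫ x in sphere x₀ θ,
      (⟪gradient v x, θ⁻¹ • (x - x₀)⟫) * u x ∂μH[(N : ℝ) - 1]

/-- The quadratic boundary form
`Q_{θ,i}(u,v) = -∫_{∂B_θ(x₀)} ⟨∇v,ν⟩ ∂u/∂x_i - ∫ ⟨∇u,ν⟩ ∂v/∂x_i + ∫ ⟨∇u,∇v⟩ ν_i`,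
where `ν(x) = (x-x₀)/θ` and integrals are over the sphere `∂B_θ(x₀)` with respect to the
`(N-1)`-dimensional Hausdorff measure. -/
noncomputable def Qform {N : ℕ} (x₀ : EuclideanSpace ℝ (Fin N)) (θ : ℝ) (i : Fin N)
    (u v : EuclideanSpace ℝ (Fin N) → ℝ) : ℝ :=
  -(∫ x in sphere x₀ θ,
      (⟪gradient v x, θ⁻¹ • (x - x₀)⟫) * fderiv ℝ u x (EuclideanSpace.single i 1)
        ∂μH[(N : ℝ) - 1])
  - ∫ x in sphere x₀ θ,
      (⟪gradient u x, θ⁻¹ • (x - x₀)⟫) * fderiv ℝ v x (EuclideanSpace.single i 1)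
        ∂μH[(N : ℝ) - 1]
  + ∫ x in sphere x₀ θ,
      (⟪gradient u x, gradient v x⟫) * ((x - x₀) i / θ) ∂μH[(N : ℝ) - 1]

/-- The `(N-1)`-dimensional surface measure of the unit sphere in `ℝ^N`. -/
noncomputable def omegaN (N : ℕ) : ℝ :=
  (μH[(N : ℝ) - 1] (sphere (0 : EuclideanSpace ℝ (Fin N)) 1)).toReal

/-- The fundamental solution `S_{x₀}(x) = 1/((N-2) ω_N |x-x₀|^{N-2})` of `-Δ` with pole `x₀`. -/
noncomputable def fundSol {N : ℕ} (x₀ x : EuclideanSpace ℝ (Fin N)) : ℝ :=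
  1 / (((N : ℝ) - 2) * omegaN N * ‖x - x₀‖ ^ (N - 2))

/-- `W_{x₀,h}(x) = (x_h - (x₀)_h)/(ω_N |x-x₀|^N)`, the partial derivative of
`S_{x₀}(x)` with respect to the `h`-th coordinate of the pole `x₀`. -/
noncomputable def poleDeriv {N : ℕ} (x₀ : EuclideanSpace ℝ (Fin N)) (h : Fin N)
    (x : EuclideanSpace ℝ (Fin N)) : ℝ :=
  (x h - x₀ h) / (omegaN N * ‖x - x₀‖ ^ N)

section Sphere

variable {E : Type*} [NormedAddCommGroup E] [InnerProductSpace ℝ E]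
  [MeasurableSpace E] [BorelSpace E]

open scoped Pointwise in
/-- Scaling of the Hausdorff measure of spheres. -/
theorem hausdorffMeasure_real_sphere {d : ℝ} (hd : 0 ≤ d) (x₀ : E) {r : ℝ} (hr : 0 < r) :
    μH[d].real (sphere x₀ r) = r ^ d * μH[d].real (sphere (0 : E) 1) := by
  have himg : sphere x₀ r = x₀ +ᵥ r • sphere (0 : E) 1 := by
    rw [smul_sphere' hr.ne', vadd_sphere]
    simp [abs_of_pos hr]
  rw [himg, measureReal_def, hausdorffMeasure_vadd x₀ (Or.inl hd),
    Measure.hausdorffMeasure_smul₀ hd hr.ne', ENNReal.smul_def, smul_eq_mul, ENNReal.toReal_mul]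
  simp [measureReal_def, abs_of_pos hr]

variable [FiniteDimensional ℝ E]

/-- The codimension-one Hausdorff measure of the unit sphere is finite. -/
theorem hausdorffMeasure_unitSphere_lt_top {n : ℕ} (hn : Module.finrank ℝ E = n + 1) :
    μH[(n : ℝ)] (sphere (0 : E) 1) < ∞ := by
  have : Fact (Module.finrank ℝ E = n + 1) := ⟨hn⟩
  refine (isCompact_sphere (0 : E) 1).measure_lt_top_of_nhdsWithin fun x hx => ?_
  have hx1 : ‖x‖ = 1 := by simpa using hx
  have hv : ‖-x‖ = 1 := by simpa using hx1
  have hvx : innerSL ℝ (-x) x ≠ (1 : ℝ) := by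
    simp only [innerSL_apply_apply, inner_neg_left, real_inner_self_eq_norm_sq, hx1]
    norm_num
  have hdim : Module.finrank ℝ (ℝ ∙ (-x))ᗮ = n :=
    Submodule.finrank_orthogonal_span_singleton (by
      rw [← norm_ne_zero_iff, hv]; exact one_ne_zero)
  have hsmooth : ContDiff ℝ 1 (fun w : (ℝ ∙ (-x))ᗮ => stereoInvFunAux (-x) (w : E)) :=
    contDiff_stereoInvFunAux.comp (ℝ ∙ (-x))ᗮ.subtypeL.contDiff
  obtain ⟨K, t, ht, hK⟩ := (hsmooth.contDiffAt (x := 0)).exists_lipschitzOnWith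
  have hopen : {y : E | innerSL ℝ (-x) y ≠ (1 : ℝ)} ∈ nhds x :=
    (isOpen_ne_fun (innerSL ℝ (-x)).continuous continuous_const).mem_nhds hvx
  have hcont : ContinuousAt (stereoToFun (-x)) x := continuousOn_stereoToFun.continuousAt hopen
  have hzero : stereoToFun (-x) x = 0 := by
    rw [stereoToFun_apply, Submodule.orthogonalProjectionOnto_orthogonal_apply_eq_zero, smul_zero]
    simpa using Submodule.mem_span_singleton_self (R := ℝ) (-x)
  have ht' : t ∩ closedBall 0 1 ∈ nhds (stereoToFun (-x) x) := by
    rw [hzero]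
    exact Filter.inter_mem ht (closedBall_mem_nhds _ one_pos)
  refine ⟨_, inter_mem_nhdsWithin _ (Filter.inter_mem hopen (hcont ht')), ?_⟩
  have hsub : sphere (0 : E) 1 ∩
      ({y : E | innerSL ℝ (-x) y ≠ (1 : ℝ)} ∩ stereoToFun (-x) ⁻¹' (t ∩ closedBall 0 1)) ⊆
      (fun w : (ℝ ∙ (-x))ᗮ => stereoInvFunAux (-x) (w : E)) '' (t ∩ closedBall 0 1) := by
    rintro y ⟨hy, hy1, hy2⟩
    refine ⟨_, hy2, ?_⟩
    have hne : y ≠ -x := by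
      rintro rfl
      exact hy1 (by simp [hx1])
    exact congrArg Subtype.val (stereo_left_inv hv (x := ⟨y, hy⟩) hne)
  refine (measure_mono hsub).trans_lt <|
    ((hK.mono Set.inter_subset_left).hausdorffMeasure_image_le n.cast_nonneg).trans_lt ?_
  refine ENNReal.mul_lt_top (by simp) ((measure_mono Set.inter_subset_right).trans_lt ?_)
  rw [← hdim]
  exact (isCompact_closedBall _ _).measure_lt_top

/-- The codimension-one Hausdorff measure of the unit sphere is positive. -/
theorem hausdorffMeasure_unitSphere_pos {n : ℕ} (hn : Module.finrank ℝ E = n + 1) :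
    0 < μH[(n : ℝ)] (sphere (0 : E) 1) := by
  have : Fact (Module.finrank ℝ E = n + 1) := ⟨hn⟩
  have : Nontrivial E := Module.nontrivial_of_finrank_eq_succ hn
  obtain ⟨v, hv⟩ := exists_norm_eq E zero_le_one
  have hdim : Module.finrank ℝ (ℝ ∙ v)ᗮ = n :=
    Submodule.finrank_orthogonal_span_singleton (by
      rw [← norm_ne_zero_iff, hv]; exact one_ne_zero)
  have hlip := (ℝ ∙ v)ᗮ.lipschitzWith_orthogonalProjectionOnto
  have hsub : ball (0 : (ℝ ∙ v)ᗮ) 1 ⊆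
      (ℝ ∙ v)ᗮ.orthogonalProjectionOnto '' sphere (0 : E) 1 := by
    intro w hw
    have hw1 : ‖w‖ < 1 := by simpa using hw
    have hwv : ⟪(w : E), v⟫ = 0 := Submodule.mem_orthogonal_singleton_iff_inner_left.mp w.2
    refine ⟨(w : E) + √(1 - ‖w‖ ^ 2) • v, ?_, ?_⟩
    · rw [mem_sphere_zero_iff_norm, ← sq_eq_sq₀ (norm_nonneg _) zero_le_one, norm_add_sq_real,
        inner_smul_right, hwv, norm_smul, hv, Real.norm_eq_abs, mul_one, sq_abs,
        Real.sq_sqrt (by nlinarith [norm_nonneg w])]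
      simp
    · rw [map_add, map_smul, Submodule.orthogonalProjectionOnto_mem_subspace_eq_self,
        Submodule.orthogonalProjectionOnto_orthogonal_apply_eq_zero, smul_zero, add_zero]
      exact Submodule.mem_span_singleton_self v
  have hball : 0 < μH[(n : ℝ)] (ball (0 : (ℝ ∙ v)ᗮ) 1) := by
    rw [← hdim]
    exact measure_ball_pos _ _ one_pos
  have h := hlip.hausdorffMeasure_image_le (d := n) n.cast_nonneg (sphere (0 : E) 1)
  simp only [ENNReal.coe_one, ENNReal.one_rpow, one_mul] at h
  exact hball.trans_le ((measure_mono hsub).trans h)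

end Sphere

section EuclideanSpace

variable {N : ℕ} (x₀ : EuclideanSpace ℝ (Fin N))

theorem hausdorffMeasure_real_sphere_eq_omegaN (hN : 1 ≤ N) {θ : ℝ} (hθ : 0 < θ) :
    μH[(N : ℝ) - 1].real (sphere x₀ θ) = omegaN N * θ ^ (N - 1) := by
  have hcast : (N : ℝ) - 1 = ((N - 1 : ℕ) : ℝ) := by push_cast [hN]; ring
  rw [omegaN, ← measureReal_def, hcast, hausdorffMeasure_real_sphere (Nat.cast_nonneg _) x₀ hθ,
    Real.rpow_natCast, mul_comm]

theorem omegaN_pos (hN : 1 ≤ N) : 0 < omegaN N := by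
  have hcast : (N : ℝ) - 1 = ((N - 1 : ℕ) : ℝ) := by push_cast [hN]; ring
  have hrank : Module.finrank ℝ (EuclideanSpace ℝ (Fin N)) = N - 1 + 1 := by simp; omega
  rw [omegaN, hcast]
  exact ENNReal.toReal_pos (hausdorffMeasure_unitSphere_pos hrank).ne'
    (hausdorffMeasure_unitSphere_lt_top hrank).ne

theorem hausdorffMeasure_sphere_lt_top (hN : 1 ≤ N) {θ : ℝ} (hθ : 0 < θ) :
    μH[(N : ℝ) - 1] (sphere x₀ θ) < ∞ := by
  refine lt_top_iff_ne_top.2 fun htop => ?_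
  have h := hausdorffMeasure_real_sphere_eq_omegaN x₀ hN hθ
  rw [measureReal_def, htop, ENNReal.toReal_top] at h
  exact (mul_pos (omegaN_pos hN) (pow_pos hθ _)).ne h

theorem integrableOn_sphere_of_continuousOn (hN : 1 ≤ N) {θ : ℝ} (hθ : 0 < θ)
    {f : EuclideanSpace ℝ (Fin N) → ℝ} (hf : ContinuousOn f (sphere x₀ θ)) :
    IntegrableOn f (sphere x₀ θ) μH[(N : ℝ) - 1] := by
  obtain ⟨C, hC⟩ := (isCompact_sphere x₀ θ).exists_bound_of_continuousOn hf
  exact IntegrableOn.of_bound (hausdorffMeasure_sphere_lt_top x₀ hN hθ)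
    (hf.aestronglyMeasurable isClosed_sphere.measurableSet) C
    ((ae_restrict_iff' isClosed_sphere.measurableSet).2 (Filter.Eventually.of_forall hC))

theorem hasGradientAt_fundSol (hN : 3 ≤ N) {x : EuclideanSpace ℝ (Fin N)} (hx : x ≠ x₀) :
    HasGradientAt (fundSol x₀) (-(omegaN N * ‖x - x₀‖ ^ N)⁻¹ • (x - x₀)) x := by
  have hN2 : (N : ℝ) - 2 ≠ 0 := by
    have : (3 : ℝ) ≤ N := by exact_mod_cast hN
    linarith
  have hr : 0 < ‖x - x₀‖ := norm_pos_iff.2 (sub_ne_zero.2 hx)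
  have hpow : ∀ y, (‖y - x₀‖ ^ 2) ^ (-((N : ℝ) - 2) / 2) = (‖y - x₀‖ ^ (N - 2))⁻¹ := by
    intro y
    rw [← Real.rpow_natCast, ← Real.rpow_mul (norm_nonneg _), ← Real.rpow_natCast,
      ← Real.rpow_neg (norm_nonneg _)]
    congr 1
    push_cast [show 2 ≤ N by omega]
    ring
  have hfun : fundSol x₀ = fun y => (((N : ℝ) - 2) * omegaN N)⁻¹ *
      (‖y - x₀‖ ^ 2) ^ (-((N : ℝ) - 2) / 2) := by
    ext y
    rw [hpow, fundSol, one_div, mul_inv]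
  have hsq : HasFDerivAt (fun y => ‖y - x₀‖ ^ 2) (2 • innerSL ℝ (x - x₀)) x := by
    simpa using ((hasFDerivAt_id x).sub_const x₀).norm_sq
  have hder := (hsq.rpow_const (p := -((N : ℝ) - 2) / 2) (Or.inl (by positivity))).const_mul
    (((N : ℝ) - 2) * omegaN N)⁻¹
  rw [hasGradientAt_iff_hasFDerivAt, hfun]
  refine hder.congr_fderiv ?_
  have hexp : (‖x - x₀‖ ^ 2) ^ (-((N : ℝ) - 2) / 2 - 1) = (‖x - x₀‖ ^ N)⁻¹ := by
    rw [← Real.rpow_natCast, ← Real.rpow_mul (norm_nonneg _), ← Real.rpow_natCast,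
      ← Real.rpow_neg (norm_nonneg _)]
    congr 1
    push_cast
    ring
  ext w
  rw [hexp]
  simp
  field_simp
  ring

theorem fundSol_of_mem_sphere (hN : 3 ≤ N) {θ : ℝ} (hθ : 0 < θ) {x : EuclideanSpace ℝ (Fin N)}
    (hx : x ∈ sphere x₀ θ) :
    fundSol x₀ x = θ * (omegaN N * θ ^ (N - 1))⁻¹ / ((N : ℝ) - 2) := by
  have hpow : θ ^ (N - 1) = θ ^ (N - 2) * θ := by rw [← pow_succ]; congr 1; omega
  rw [fundSol, ← dist_eq_norm, mem_sphere.1 hx, hpow]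
  field_simp

theorem gradient_fundSol_sub (hN : 3 ≤ N) {θ : ℝ} (hθ : 0 < θ) {Φ : EuclideanSpace ℝ (Fin N) → ℝ}
    {x : EuclideanSpace ℝ (Fin N)} (hx : x ∈ sphere x₀ θ) (hΦ : DifferentiableAt ℝ Φ x) :
    gradient (fun y => fundSol x₀ y - Φ y) x =
      -(omegaN N * θ ^ (N - 1))⁻¹ • θ⁻¹ • (x - x₀) - gradient Φ x := by
  have hpow : θ ^ N = θ ^ (N - 1) * θ := by rw [← pow_succ]; congr 1; omega
  have h := (hasGradientAt_fundSol x₀ hN (ne_of_mem_sphere hx hθ.ne')).hasFDerivAt.sub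
    hΦ.hasGradientAt.hasFDerivAt
  rw [← map_sub] at h
  refine (hasGradientAt_iff_hasFDerivAt.2 h).gradient.trans ?_
  rw [← dist_eq_norm, mem_sphere.1 hx, hpow, smul_smul, ← mul_assoc, mul_inv, neg_mul]

/-- Quantitative form of the limit: on a small sphere, `P_θ(S - Φ, S - Φ)` differs from
`-((N-2)/2) Φ(x₀)` by `O(θ)`, for any `Φ` with controlled `C¹` size. -/
theorem abs_Pform_fundSol_sub_le (hN : 3 ≤ N) {θ : ℝ} (hθ : 0 < θ)
    {Φ : EuclideanSpace ℝ (Fin N) → ℝ} (hΦ : ∀ x ∈ sphere x₀ θ, DifferentiableAt ℝ Φ x)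
    (hΦ' : ContinuousOn (gradient Φ) (sphere x₀ θ)) {M : ℝ}
    (hgrad : ∀ x ∈ sphere x₀ θ, ‖gradient Φ x‖ ≤ M) (hval : ∀ x ∈ sphere x₀ θ, |Φ x| ≤ M)
    (hdiff : ∀ x ∈ sphere x₀ θ, |Φ x - Φ x₀| ≤ M * θ) :
    |Pform x₀ θ (fun x => fundSol x₀ x - Φ x) (fun x => fundSol x₀ x - Φ x)
        - -(((N : ℝ) - 2) / 2) * Φ x₀| ≤
      ((N : ℝ) - 1) / 2 * M * θ +
        (3 / 2 * θ * M ^ 2 + ((N : ℝ) - 2) / 2 * M ^ 2) * (omegaN N * θ ^ (N - 1)) := by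
  have hN1 : 1 ≤ N := by omega
  have hN3 : (3 : ℝ) ≤ N := by exact_mod_cast hN
  have hN2 : (N : ℝ) - 2 ≠ 0 := by linarith
  set A := omegaN N * θ ^ (N - 1) with hA
  have hApos : 0 < A := mul_pos (omegaN_pos hN1) (pow_pos hθ _)
  set S := sphere x₀ θ
  set μ : Measure (EuclideanSpace ℝ (Fin N)) := μH[(N : ℝ) - 1]
  have hμS : μ.real S = A := hausdorffMeasure_real_sphere_eq_omegaN x₀ hN1 hθ
  have hmeas : MeasurableSet S := isClosed_sphere.measurableSet
  set g : EuclideanSpace ℝ (Fin N) → ℝ := fun x => ⟪gradient Φ x, θ⁻¹ • (x - x₀)⟫ with hg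
  set k : EuclideanSpace ℝ (Fin N) → ℝ := fun x => ‖gradient Φ x‖ ^ 2 with hk
  have hν : ∀ x ∈ S, ‖θ⁻¹ • (x - x₀)‖ = 1 := fun x hx => by
    rw [norm_smul, ← dist_eq_norm, mem_sphere.1 hx, norm_inv, Real.norm_of_nonneg hθ.le,
      inv_mul_cancel₀ hθ.ne']
  have hΦc : ContinuousOn Φ S := fun x hx => (hΦ x hx).continuousAt.continuousWithinAt
  have hgc : ContinuousOn g S := hΦ'.inner (by fun_prop)
  have hkc : ContinuousOn k S := hΦ'.norm.pow 2
  have hnormal : ∀ x ∈ S, ⟪gradient (fun y => fundSol x₀ y - Φ y) x, θ⁻¹ • (x - x₀)⟫ =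
      -A⁻¹ - g x := fun x hx => by
    rw [gradient_fundSol_sub x₀ hN hθ hx (hΦ x hx), inner_sub_left, inner_smul_left,
      real_inner_self_eq_norm_sq, hν x hx]
    simp [hg, hA]
  have hsq : ∀ x ∈ S, ⟪gradient (fun y => fundSol x₀ y - Φ y) x,
      gradient (fun y => fundSol x₀ y - Φ y) x⟫ = A⁻¹ ^ 2 + 2 * A⁻¹ * g x + k x := fun x hx => by
    rw [gradient_fundSol_sub x₀ hN hθ hx (hΦ x hx), real_inner_self_eq_norm_sq, norm_sub_sq_real,
      norm_smul, hν x hx, inner_smul_left, real_inner_comm]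
    simp only [hg, hk, norm_neg, Real.norm_eq_abs, mul_one, sq_abs, map_neg, conj_trivial]
    ring
  have hI {f : EuclideanSpace ℝ (Fin N) → ℝ} (hf : ContinuousOn f S) : IntegrableOn f S μ :=
    integrableOn_sphere_of_continuousOn x₀ hN1 hθ hf
  have h1 : IntegrableOn (fun x => (-A⁻¹ - g x) * (-A⁻¹ - g x)) S μ := hI (by fun_prop)
  have h2 : IntegrableOn (fun x => A⁻¹ ^ 2 + 2 * A⁻¹ * g x + k x) S μ := hI (by fun_prop)
  have h3 : IntegrableOn (fun x => (-A⁻¹ - g x) * (θ * A⁻¹ / ((N : ℝ) - 2) - Φ x)) S μ :=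
    hI (by fun_prop)
  have h4 : IntegrableOn (fun _ => ((N : ℝ) - 2) / 2 * Φ x₀ * A⁻¹) S μ :=
    hI continuousOn_const
  have e1 : ∫ x in S, (⟪gradient (fun y => fundSol x₀ y - Φ y) x, θ⁻¹ • (x - x₀)⟫) *
      (⟪gradient (fun y => fundSol x₀ y - Φ y) x, θ⁻¹ • (x - x₀)⟫) ∂μ =
      ∫ x in S, (-A⁻¹ - g x) * (-A⁻¹ - g x) ∂μ :=
    setIntegral_congr_fun hmeas fun x hx => by simp only [hnormal x hx]
  have e2 : ∫ x in S, (⟪gradient (fun y => fundSol x₀ y - Φ y) x,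
      gradient (fun y => fundSol x₀ y - Φ y) x⟫) ∂μ =
      ∫ x in S, (A⁻¹ ^ 2 + 2 * A⁻¹ * g x + k x) ∂μ :=
    setIntegral_congr_fun hmeas hsq
  have e3 : ∫ x in S, (⟪gradient (fun y => fundSol x₀ y - Φ y) x, θ⁻¹ • (x - x₀)⟫) *
      (fundSol x₀ x - Φ x) ∂μ =
      ∫ x in S, (-A⁻¹ - g x) * (θ * A⁻¹ / ((N : ℝ) - 2) - Φ x) ∂μ :=
    setIntegral_congr_fun hmeas fun x hx => by
      simp only [hnormal x hx, fundSol_of_mem_sphere x₀ hN hθ hx, hA]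
  have e4 : ((N : ℝ) - 2) / 2 * Φ x₀ = ∫ _ in S, ((N : ℝ) - 2) / 2 * Φ x₀ * A⁻¹ ∂μ := by
    rw [setIntegral_const, hμS, smul_eq_mul]
    field_simp
  have hrem : Pform x₀ θ (fun x => fundSol x₀ x - Φ x) (fun x => fundSol x₀ x - Φ x)
      - -(((N : ℝ) - 2) / 2) * Φ x₀ =
      ∫ x in S, (-(A⁻¹ * θ * g x / 2) - θ * g x ^ 2 + θ / 2 * k x
        - ((N : ℝ) - 2) / 2 * (g x * Φ x) - ((N : ℝ) - 2) / 2 * A⁻¹ * (Φ x - Φ x₀)) ∂μ := by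
    rw [Pform, neg_mul (((N : ℝ) - 2) / 2), sub_neg_eq_add, e1, e2, e3, e4,
      ← integral_const_mul, ← integral_const_mul, ← integral_const_mul,
      ← integral_add (h1.const_mul _) (h2.const_mul _),
      ← integral_add ((h1.const_mul _).fun_add (h2.const_mul _)) (h3.const_mul _),
      ← integral_add (((h1.const_mul _).fun_add (h2.const_mul _)).fun_add (h3.const_mul _))
        (h3.const_mul _),
      ← integral_add ((((h1.const_mul _).fun_add (h2.const_mul _)).fun_add (h3.const_mul _)).fun_add
        (h3.const_mul _)) h4]
    refine integral_congr_ae (Filter.Eventually.of_forall fun x => ?_)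
    field_simp
    ring
  rw [hrem, ← Real.norm_eq_abs]
  refine (norm_setIntegral_le_of_norm_le_const (C := A⁻¹ * θ * M / 2 + θ * M ^ 2 + θ / 2 * M ^ 2
    + ((N : ℝ) - 2) / 2 * (M * M) + ((N : ℝ) - 2) / 2 * A⁻¹ * (M * θ))
    (hausdorffMeasure_sphere_lt_top x₀ hN1 hθ) fun x hx => ?_).trans_eq ?_
  · have hM : 0 ≤ M := (norm_nonneg _).trans (hgrad x hx)
    have hgM : |g x| ≤ M := (abs_real_inner_le_norm _ _).trans (by
      rw [hν x hx, mul_one]; exact hgrad x hx)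
    have hN2' : 0 ≤ ((N : ℝ) - 2) / 2 := by linarith
    have b1 : |A⁻¹ * θ * g x / 2| ≤ A⁻¹ * θ * M / 2 := by
      rw [abs_div, abs_mul, abs_of_nonneg (by positivity : 0 ≤ A⁻¹ * θ), abs_two]
      gcongr
    have b2 : |θ * g x ^ 2| ≤ θ * M ^ 2 := by
      rw [abs_mul, abs_pow, abs_of_pos hθ]
      gcongr
    have b3 : |θ / 2 * k x| ≤ θ / 2 * M ^ 2 := by
      rw [abs_of_nonneg (by positivity)]
      have := hgrad x hx
      simp only [hk]
      gcongr
    have b4 : |((N : ℝ) - 2) / 2 * (g x * Φ x)| ≤ ((N : ℝ) - 2) / 2 * (M * M) := by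
      have := hval x hx
      rw [abs_mul, abs_mul, abs_of_nonneg hN2']
      gcongr
    have b5 : |((N : ℝ) - 2) / 2 * A⁻¹ * (Φ x - Φ x₀)| ≤
        ((N : ℝ) - 2) / 2 * A⁻¹ * (M * θ) := by
      have := hdiff x hx
      rw [abs_mul, abs_of_nonneg (by positivity)]
      gcongr
    rw [Real.norm_eq_abs]
    rw [abs_le] at b1 b2 b3 b4 b5 ⊢
    constructor <;> linarith [b1.1, b1.2, b2.1, b2.2, b3.1, b3.2, b4.1, b4.2, b5.1, b5.2]
  · rw [hμS]
    field_simp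
    ring

end EuclideanSpace

/-- If `Φ` is harmonic on a ball `B_d(x₀)` and `G = S_{x₀} - Φ`, then
`P_θ(G, G) → -((N-2)/2) Φ(x₀)` as `θ → 0⁺`.  (When `G` is the Green's function of a
domain with pole `x₀` and `Φ` its regular part, the right-hand side is `-((N-2)/2)` times
the Robin function at `x₀`.) -/
theorem Pform_green_green_limit {N : ℕ} (hN : 3 ≤ N)
    (x₀ : EuclideanSpace ℝ (Fin N)) (d : ℝ) (hd : 0 < d)
    (Φ : EuclideanSpace ℝ (Fin N) → ℝ)
    (hΦ : ContDiffOn ℝ 2 Φ (ball x₀ d))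
    (hΦ0 : ∀ x ∈ ball x₀ d, laplacian Φ x = 0) :
    Filter.Tendsto
      (fun θ : ℝ => Pform x₀ θ (fun x => fundSol x₀ x - Φ x) (fun x => fundSol x₀ x - Φ x))
      (nhdsWithin 0 (Set.Ioi 0)) (nhds (-(((N : ℝ) - 2) / 2) * Φ x₀)) := by
  have hball : ball x₀ d ∈ nhds x₀ := ball_mem_nhds x₀ hd
  have hΦ1 : ContDiffOn ℝ 1 Φ (ball x₀ d) := hΦ.of_le (by norm_num)
  have hat : ContDiffAt ℝ 1 Φ x₀ := hΦ1.contDiffAt hball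
  have hgradc : ContinuousOn (gradient Φ) (ball x₀ d) :=
    (InnerProductSpace.toDual ℝ _).symm.continuous.comp_continuousOn
      (hΦ1.continuousOn_fderiv_of_isOpen isOpen_ball le_rfl)
  obtain ⟨K, t, ht, hK⟩ := hat.exists_lipschitzOnWith
  obtain ⟨M, hM1, hM2, hM3⟩ :
      ∃ M : ℝ, ‖gradient Φ x₀‖ < M ∧ |Φ x₀| < M ∧ (K : ℝ) ≤ M :=
    ⟨‖gradient Φ x₀‖ + |Φ x₀| + K + 1, by
      have := abs_nonneg (Φ x₀); have := norm_nonneg (gradient Φ x₀)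
      refine ⟨?_, ?_, ?_⟩ <;> linarith [K.coe_nonneg]⟩
  have hg : ∀ᶠ x in nhds x₀, ‖gradient Φ x‖ < M :=
    (hgradc.continuousAt hball).norm.eventually_lt_const hM1
  have hv : ∀ᶠ x in nhds x₀, |Φ x| < M := hat.continuousAt.abs.eventually_lt_const hM2
  obtain ⟨ε, hε, hsub⟩ := Metric.eventually_nhds_iff.1 (hg.and (hv.and (Filter.Eventually.and
    (Filter.eventually_mem_set.2 ht) (Filter.eventually_mem_set.2 hball))))
  have hbound : Filter.Tendsto (fun θ : ℝ => ((N : ℝ) - 1) / 2 * M * θ +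
      (3 / 2 * θ * M ^ 2 + ((N : ℝ) - 2) / 2 * M ^ 2) * (omegaN N * θ ^ (N - 1)))
      (nhdsWithin 0 (Set.Ioi 0)) (nhds 0) := by
    refine Filter.Tendsto.mono_left ?_ nhdsWithin_le_nhds
    refine Continuous.tendsto' (by fun_prop) _ _ ?_
    simp [show N - 1 ≠ 0 by omega]
  rw [tendsto_iff_dist_tendsto_zero]
  refine squeeze_zero' (Filter.Eventually.of_forall fun _ => dist_nonneg) ?_ hbound
  filter_upwards [Ioo_mem_nhdsGT hε] with θ hθ
  have hmem : ∀ x ∈ sphere x₀ θ, dist x x₀ < ε := fun x hx => (mem_sphere.1 hx).trans_lt hθ.2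
  refine abs_Pform_fundSol_sub_le x₀ hN hθ.1 (fun x hx => ?_) (fun x hx => ?_)
    (fun x hx => (hsub (hmem x hx)).1.le) (fun x hx => (hsub (hmem x hx)).2.1.le) fun x hx => ?_
  · exact (hΦ1.contDiffAt (isOpen_ball.mem_nhds (hsub (hmem x hx)).2.2.2)).differentiableAt
      one_ne_zero
  · exact (hgradc.continuousAt
      (isOpen_ball.mem_nhds (hsub (hmem x hx)).2.2.2)).continuousWithinAt
  · rw [← Real.dist_eq, ← mem_sphere.1 hx]
    exact (hK.dist_le_mul x (hsub (hmem x hx)).2.2.1 x₀ (mem_of_mem_nhds ht)).trans (by gcongr)
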